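/- For every well-quasi-order (S,≤), the class of (S,≤)-labeled finite simple graphs that admit a cycle-multipartite decomposition is well-quasi-ordered by the label-respecting induced minor relation. -/

import Mathlib

open SimpleGraph

namespace IMWQO

/-- `H` is an induced minor of `G`: there is a family of pairwise disjoint nonempty
connected subsets of `V(G)`, indexed by `V(H)`, such that distinct branch sets are
joined by an edge of `G` iff the corresponding vertices are adjacent in `H`. -/
def IsInducedMinor {α β : Type*} (H : SimpleGraph α) (G : SimpleGraph β) : Prop :=
  ∃ μ : α → Set β,
    (∀ a, (μ a).Nonempty) ∧
    (∀ a b, a ≠ b → Disjoint (μ a) (μ b)) ∧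
    (∀ a, (G.induce (μ a)).Connected) ∧
    (∀ a b, a ≠ b → ((∃ x ∈ μ a, ∃ y ∈ μ b, G.Adj x y) ↔ H.Adj a b))

/-- A bundled finite simple graph. -/
abbrev FinGraph := Σ n : ℕ, SimpleGraph (Fin n)

/-- The induced minor relation on bundled finite graphs. -/
def FinGraph.IM (H G : FinGraph) : Prop := IsInducedMinor H.2 G.2

/-- A class of finite graphs is well-quasi-ordered by the induced minor relation. -/
def WqoClass (P : FinGraph → Prop) : Prop :=
  ∀ f : ℕ → FinGraph, (∀ i, P (f i)) → ∃ i j, i < j ∧ FinGraph.IM (f i) (f j)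

/-- `K̂₄`: `K₄` (on vertices `0,1,2,3`) plus a vertex `4` adjacent to `0` and `1`. -/
def hatK4 : SimpleGraph (Fin 5) :=
  SimpleGraph.fromRel fun a b =>
    (a.val < 4 ∧ b.val < 4) ∨ (a.val = 4 ∧ (b.val = 0 ∨ b.val = 1))

/-- The gem: the path `0 - 1 - 2 - 3` plus a dominating vertex `4`. -/
def gem : SimpleGraph (Fin 5) :=
  SimpleGraph.fromRel fun a b =>
    (b.val = a.val + 1 ∧ b.val ≤ 3) ∨ a.val = 4

/-- The complete graph on four vertices. -/
def K4 : SimpleGraph (Fin 4) := ⊤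

/-- The prism, i.e. the Cartesian (box) product `K₃ □ K₂`. -/
def prism : SimpleGraph (Fin 3 × Fin 2) :=
  (⊤ : SimpleGraph (Fin 3)) □ (⊤ : SimpleGraph (Fin 2))

/-- The complete bipartite graph `K_{3,3}`. -/
def K33 : SimpleGraph (Fin 3 ⊕ Fin 3) := completeBipartiteGraph (Fin 3) (Fin 3)

/-- Subdivide the edge `{u,v}` of `G`, the new vertex being `Fin.last n`. -/
def subdivideEdge {n : ℕ} (G : SimpleGraph (Fin n)) (u v : Fin n) :
    SimpleGraph (Fin (n + 1)) :=
  SimpleGraph.fromRel fun a b =>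
    (∃ a' b' : Fin n, a = a'.castSucc ∧ b = b'.castSucc ∧ G.Adj a' b' ∧
      ¬(a' = u ∧ b' = v) ∧ ¬(a' = v ∧ b' = u))
    ∨ (a = Fin.last n ∧ (b = u.castSucc ∨ b = v.castSucc))

/-- One subdivision step on bundled graphs: the first graph is obtained from the
second one by subdividing one edge. -/
inductive SubdivStep : FinGraph → FinGraph → Prop
  | mk {n : ℕ} (G : SimpleGraph (Fin n)) (u v : Fin n) (h : G.Adj u v) :
      SubdivStep ⟨n + 1, subdivideEdge G u v⟩ ⟨n, G⟩

/-- `G` is (isomorphic to) a subdivision of `H`. -/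
def IsSubdivision {α β : Type*} (G : SimpleGraph α) (H : SimpleGraph β) : Prop :=
  ∃ A B : FinGraph, Nonempty (G ≃g A.2) ∧ Nonempty (H ≃g B.2) ∧
    Relation.ReflTransGen SubdivStep A B

/-- `G` contains a subdivision of `H` as a subgraph. -/
def ContainsSubdivAsSubgraph {α β : Type*} (G : SimpleGraph α) (H : SimpleGraph β) : Prop :=
  ∃ S : G.Subgraph, IsSubdivision S.coe H

/-- `G` has a proper `K₄`-subdivision: for some vertex `v`, `G - v` contains
a subdivision of `K₄` as a subgraph. -/
def HasProperK4Subdivision {α : Type*} (G : SimpleGraph α) : Prop :=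
  ∃ v : α, ContainsSubdivAsSubgraph (G.induce {u | u ≠ v}) K4

/-- `G` is 2-connected: at least 3 vertices, and removing any vertex leaves it connected. -/
def TwoConnected {α : Type*} [Fintype α] (G : SimpleGraph α) : Prop :=
  3 ≤ Fintype.card α ∧ ∀ v : α, (G.induce {u | u ≠ v}).Connected

/-- `G` is complete multipartite: two vertices are adjacent iff they lie in different
classes of some partition (equivalence relation). -/
def IsCompleteMultipartite {α : Type*} (G : SimpleGraph α) : Prop :=
  ∃ s : Setoid α, ∀ u v, G.Adj u v ↔ ¬ s.r u v

/-- `G` is a cograph: it has no induced path on four vertices. -/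
def IsCograph {α : Type*} (G : SimpleGraph α) : Prop :=
  ∀ f : Fin 4 → α, Function.Injective f →
    ¬ (∀ a b : Fin 4, G.Adj (f a) (f b) ↔ (pathGraph 4).Adj a b)

/-- `G` is a linear forest: acyclic with maximum degree at most 2,
i.e. a disjoint union of paths. -/
def IsLinearForest {α : Type*} (G : SimpleGraph α) : Prop :=
  G.IsAcyclic ∧ ∀ v, (G.neighborSet v).ncard ≤ 2

/-- The set `C` induces an (induced) cycle in `G`. -/
def InducesCycle {α : Type*} (G : SimpleGraph α) (C : Set α) : Prop :=
  ∃ n : ℕ, 3 ≤ n ∧ Nonempty ((G.induce C) ≃g cycleGraph n)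

/-- The set `S` induces a path in `G` all of whose internal vertices have degree two
in `G`. -/
def IsBasicPath {α : Type*} (G : SimpleGraph α) (S : Set α) : Prop :=
  ∃ (n : ℕ) (φ : (G.induce S) ≃g pathGraph n),
    ∀ v : S, (φ v).val ≠ 0 → (φ v).val ≠ n - 1 → (G.neighborSet v.val).ncard = 2

/-- The wheel with cycle `0, …, n-1` and center adjacent to the vertices of `T`. -/
def wheelGraph (n : ℕ) (T : Finset (Fin n)) : SimpleGraph (Fin n ⊕ Unit) :=
  SimpleGraph.fromRel fun a b =>
    (∃ x y : Fin n, a = Sum.inl x ∧ b = Sum.inl y ∧ (cycleGraph n).Adj x y)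
    ∨ (∃ x ∈ T, a = Sum.inr () ∧ b = Sum.inl x)

/-- `G` is a `k`-wheel: a cycle of order at least `max k 3` plus a center adjacent to
exactly `k` distinct vertices of the cycle. -/
def IsWheel {α : Type*} (k : ℕ) (G : SimpleGraph α) : Prop :=
  ∃ n : ℕ, 3 ≤ n ∧ k ≤ n ∧ ∃ T : Finset (Fin n), T.card = k ∧
    Nonempty (G ≃g wheelGraph n T)

/-- A 3-wheel subgraph of `G`: a cycle of `G` together with a center outside the cycle
joined to (at least) three distinct vertices of the cycle by edges of `G`. -/
structure ThreeWheelSub {α : Type*} (G : SimpleGraph α) where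
  base : α
  cyc : G.Walk base base
  cyc_isCycle : cyc.IsCycle
  center : α
  center_not_mem : center ∉ cyc.support
  spokes : Finset α
  spokes_card : spokes.card = 3
  spokes_sub : ∀ x ∈ spokes, x ∈ cyc.support
  spokes_adj : ∀ x ∈ spokes, G.Adj center x

/-- The number of vertices of a 3-wheel subgraph. -/
def ThreeWheelSub.order {α : Type*} [DecidableEq α] {G : SimpleGraph α}
    (W : ThreeWheelSub G) : ℕ :=
  W.cyc.support.toFinset.card + 1

/-- `G` has a cycle-multipartite decomposition. -/
def HasCycleMultipartiteDecomp {α : Type*} (G : SimpleGraph α) : Prop :=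
  ∃ C R : Set α, C ∪ R = Set.univ ∧ Disjoint C R ∧
    InducesCycle G C ∧ IsCompleteMultipartite (G.induce R) ∧
    ∀ u ∈ R, ∀ v ∈ R, ∀ c ∈ C, (G.Adj u c ↔ G.Adj v c)

/-- A bundled finite simple graph whose vertices are labeled by finite subsets of `S`. -/
structure LabGraph (S : Type*) where
  n : ℕ
  graph : SimpleGraph (Fin n)
  label : Fin n → Finset S

/-- The domination order on finite subsets of a quasi-order: `A ≤^P B` iff there is an
injection `φ : A → B` with `r a (φ a)` for all `a ∈ A`. -/
def FinsetLE {S : Type*} (r : S → S → Prop) (A B : Finset S) : Prop :=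
  ∃ φ : {x // x ∈ A} → {x // x ∈ B}, Function.Injective φ ∧ ∀ a, r a.val (φ a).val

/-- The union of the labels of the vertices in `A`. -/
noncomputable def labelUnion {S : Type*} {n : ℕ} (lab : Fin n → Finset S)
    (A : Finset (Fin n)) : Finset S :=
  letI := Classical.decEq S
  A.biUnion lab

/-- Label-respecting induced minor relation on labeled graphs. -/
def LabIM {S : Type*} (r : S → S → Prop) (H G : LabGraph S) : Prop :=
  ∃ μ : Fin H.n → Finset (Fin G.n),
    (∀ a, (μ a).Nonempty) ∧
    (∀ a b, a ≠ b → Disjoint (μ a) (μ b)) ∧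
    (∀ a, (G.graph.induce (↑(μ a) : Set (Fin G.n))).Connected) ∧
    (∀ a b, a ≠ b → ((∃ x ∈ μ a, ∃ y ∈ μ b, G.graph.Adj x y) ↔ H.graph.Adj a b)) ∧
    (∀ a, FinsetLE r (H.label a) (labelUnion G.label (μ a)))

/-- Label-respecting contraction relation on labeled graphs: an induced minor model
whose branch sets cover all vertices. -/
def LabContraction {S : Type*} (r : S → S → Prop) (H G : LabGraph S) : Prop :=
  ∃ μ : Fin H.n → Finset (Fin G.n),
    (∀ a, (μ a).Nonempty) ∧
    (∀ a b, a ≠ b → Disjoint (μ a) (μ b)) ∧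
    (∀ x : Fin G.n, ∃ a, x ∈ μ a) ∧
    (∀ a, (G.graph.induce (↑(μ a) : Set (Fin G.n))).Connected) ∧
    (∀ a b, a ≠ b → ((∃ x ∈ μ a, ∃ y ∈ μ b, G.graph.Adj x y) ↔ H.graph.Adj a b)) ∧
    (∀ a, FinsetLE r (H.label a) (labelUnion G.label (μ a)))

/-- Label-respecting induced subgraph relation on labeled graphs. -/
def LabISub {S : Type*} (r : S → S → Prop) (H G : LabGraph S) : Prop :=
  ∃ φ : Fin H.n → Fin G.n, Function.Injective φ ∧
    (∀ a b, H.graph.Adj a b ↔ G.graph.Adj (φ a) (φ b)) ∧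
    (∀ a, FinsetLE r (H.label a) (G.label (φ a)))

/-- A relation is a well-quasi-order: every infinite sequence contains a good pair. -/
def IsWqo {S : Type*} (r : S → S → Prop) : Prop :=
  ∀ g : ℕ → S, ∃ i j, i < j ∧ r (g i) (g j)


section WellQuasiOrders

variable {A : Type*} {r : A → A → Prop}

theorem wellQuasiOrdered_sublistForall₂ [IsPreorder A r] (h : WellQuasiOrdered r) :
    WellQuasiOrdered (List.SublistForall₂ r) := by
  have := Set.PartiallyWellOrderedOn.partiallyWellOrderedOn_sublistForall₂ r
    (Set.partiallyWellOrderedOn_univ_iff.2 h)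
  simpa [Set.partiallyWellOrderedOn_univ_iff] using this

instance isPreorder_sublistForall₂ [IsPreorder A r] :
    IsPreorder (List A) (List.SublistForall₂ r) where

instance isPreorder_prod {B : Type*} {s : B → B → Prop} [IsPreorder A r] [IsPreorder B s] :
    IsPreorder (A × B) (fun a b => r a.1 b.1 ∧ s a.2 b.2) where
  refl _ := ⟨refl_of r _, refl_of s _⟩
  trans _ _ _ h₁ h₂ := ⟨trans_of r h₁.1 h₂.1, trans_of s h₁.2 h₂.2⟩

/-- The list of values of a finite family, in some arbitrary order. -/
noncomputable def valueList {ι : Type*} [Fintype ι] (f : ι → A) : List A :=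
  List.ofFn (f ∘ (Fintype.equivFin ι).symm)

theorem exists_embedding_of_sublistForall₂ {l₁ l₂ : List A} (h : List.SublistForall₂ r l₁ l₂) :
    ∃ φ : Fin l₁.length ↪ Fin l₂.length, ∀ k, r (l₁.get k) (l₂.get (φ k)) := by
  obtain ⟨l, hl, hsub⟩ := List.sublistForall₂_iff.1 h
  obtain ⟨φ, hφ⟩ := List.sublist_iff_exists_fin_orderEmbedding_get_eq.1 hsub
  refine ⟨(finCongr hl.length_eq).toEmbedding.trans φ.toEmbedding, fun k => ?_⟩
  change r _ (l₂.get (φ (finCongr hl.length_eq k)))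
  rw [← hφ]
  exact hl.get k.2 (hl.length_eq ▸ k.2)

theorem exists_embedding_of_valueList {ι κ : Type*} [Fintype ι] [Fintype κ] {f : ι → A} {g : κ → A}
    (h : List.SublistForall₂ r (valueList f) (valueList g)) :
    ∃ φ : ι ↪ κ, ∀ i, r (f i) (g (φ i)) := by
  obtain ⟨φ, hφ⟩ := exists_embedding_of_sublistForall₂ h
  have e₁ : (valueList f).length = Fintype.card ι := by simp [valueList]
  have e₂ : (valueList g).length = Fintype.card κ := by simp [valueList]
  refine ⟨((Fintype.equivFin ι).trans (finCongr e₁.symm)).toEmbedding.trans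
    (φ.trans ((finCongr e₂).trans (Fintype.equivFin κ).symm).toEmbedding), fun i => ?_⟩
  have := hφ (finCongr e₁.symm (Fintype.equivFin ι i))
  simp only [valueList, List.get_ofFn, Function.comp_apply] at this
  convert this
  · exact ((Fintype.equivFin ι).symm_apply_apply i).symm
  · rfl

theorem FinsetLE.mono_right {A B C : Finset S} {r : S → S → Prop} (h : FinsetLE r A B)
    (hBC : B ⊆ C) : FinsetLE r A C := by
  obtain ⟨φ, hφ, hr⟩ := h
  exact ⟨fun a => ⟨φ a, hBC (φ a).2⟩,
    fun a b hab => hφ (Subtype.ext (Subtype.mk.inj hab)), hr⟩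

instance isPreorder_finsetLE [IsPreorder A r] : IsPreorder (Finset A) (FinsetLE r) where
  refl _ := ⟨id, Function.injective_id, fun _ => refl_of r _⟩
  trans _ _ _ h₁ h₂ := by
    obtain ⟨φ, hφ, hr⟩ := h₁
    obtain ⟨ψ, hψ, hs⟩ := h₂
    exact ⟨ψ ∘ φ, hψ.comp hφ, fun a => trans_of r (hr a) (hs (φ a))⟩

theorem wellQuasiOrdered_finsetLE [IsPreorder A r] (h : WellQuasiOrdered r) :
    WellQuasiOrdered (FinsetLE r) := by
  intro f
  obtain ⟨i, j, hij, hle⟩ := wellQuasiOrdered_sublistForall₂ h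
    fun i => valueList (Subtype.val : {x // x ∈ f i} → A)
  obtain ⟨φ, hφ⟩ := exists_embedding_of_valueList hle
  exact ⟨i, j, hij, φ, φ.injective, hφ⟩

end WellQuasiOrders

section MarkedWords

variable {A : Type*} {r : A → A → Prop}

/-- `MarkedEmb r b l l'`: the marked word `l` embeds in `l'` (letters being matched with letters
carrying the same mark and a larger value) in such a way that when every unmatched letter is merged
into the last matched letter before it, a marked letter is never merged into an unmarked one. The
flag `b` is the mark of the letter preceding both words. -/
inductive MarkedEmb (r : A → A → Prop) : Bool → List (Bool × A) → List (Bool × A) → Prop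
  | nil {b} : MarkedEmb r b [] []
  | skip {b y l l'} : (y.1 = true → b = true) → MarkedEmb r b l l' → MarkedEmb r b l (y :: l')
  | cons {b x y l l'} : x.1 = y.1 → r x.2 y.2 → MarkedEmb r x.1 l l' →
      MarkedEmb r b (x :: l) (y :: l')

theorem MarkedEmb.of_unmarked {b : Bool} {l l' : List (Bool × A)} (h : MarkedEmb r b l l')
    (hl' : ∀ y ∈ l', y.1 = false) (c : Bool) : MarkedEmb r c l l' := by
  induction h with
  | nil => exact .nil
  | skip _ _ ih =>
    simp only [List.mem_cons, forall_eq_or_imp] at hl'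
    exact .skip (by simp [hl'.1]) (ih hl'.2)
  | cons h₁ h₂ h₃ _ => exact .cons h₁ h₂ h₃

theorem MarkedEmb.append_left {l l' : List (Bool × A)} (h : MarkedEmb r true l l')
    (s : List (Bool × A)) : MarkedEmb r true l (s ++ l') := by
  induction s with
  | nil => exact h
  | cons y s ih => exact .skip (fun _ => rfl) ih

theorem MarkedEmb.of_sublistForall₂ {u v : List A} (h : List.SublistForall₂ r u v)
    {l l' : List (Bool × A)} (hl : ∀ b, MarkedEmb r b l l') (b : Bool) :
    MarkedEmb r b (u.map (false, ·) ++ l) (v.map (false, ·) ++ l') := by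
  induction h generalizing b with
  | @nil v =>
    induction v with
    | nil => exact hl b
    | cons a v ih => exact .skip (by simp) ih
  | cons hr _ ih => exact .cons rfl hr (ih _)
  | cons_right _ ih => exact .skip (by simp) (ih _)

/-- The marked word consisting of blocks, each block being an unmarked word followed by a marked
letter, and of a final unmarked word. -/
def markedWord (w : List (List A × A) × List A) : List (Bool × A) :=
  w.1.flatMap (fun s => s.1.map (false, ·) ++ [(true, s.2)]) ++ w.2.map (false, ·)

theorem markedWord_surjective : Function.Surjective (markedWord (A := A)) := by
  intro l
  induction l with
  | nil => exact ⟨([], []), rfl⟩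
  | cons x l ih =>
    obtain ⟨⟨segs, fin⟩, rfl⟩ := ih
    obtain ⟨b, a⟩ := x
    cases b with
    | true => exact ⟨(([], a) :: segs, fin), rfl⟩
    | false =>
      cases segs with
      | nil => exact ⟨([], a :: fin), rfl⟩
      | cons s segs => exact ⟨((a :: s.1, s.2) :: segs, fin), rfl⟩

/-- The order on words cut into blocks obtained by applying Higman's order to the sequence of
blocks, to each block and to the final word. -/
def BlockLE (r : A → A → Prop) (w w' : List (List A × A) × List A) : Prop :=
  List.SublistForall₂ (fun s t => List.SublistForall₂ r s.1 t.1 ∧ r s.2 t.2) w.1 w'.1 ∧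
    List.SublistForall₂ r w.2 w'.2

theorem wellQuasiOrdered_blockLE [IsPreorder A r] (h : WellQuasiOrdered r) :
    WellQuasiOrdered (BlockLE r) :=
  (wellQuasiOrdered_sublistForall₂ ((wellQuasiOrdered_sublistForall₂ h).prod h)).prod
    (wellQuasiOrdered_sublistForall₂ h)

theorem BlockLE.markedEmb {w w' : List (List A × A) × List A} (h : BlockLE r w w') :
    MarkedEmb r true (markedWord w) (markedWord w') := by
  obtain ⟨segs, fin⟩ := w
  obtain ⟨segs', fin'⟩ := w'
  obtain ⟨hsegs, hfin⟩ := h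
  have hfin' : MarkedEmb r true (fin.map (false, ·)) (fin'.map (false, ·)) := by
    simpa using MarkedEmb.of_sublistForall₂ hfin (l := []) (l' := []) (fun _ => .nil) true
  clear hfin
  simp only [markedWord] at hsegs ⊢
  induction hsegs with
  | nil => exact hfin'.append_left _
  | cons hst _ ih =>
    simp only [List.flatMap_cons, List.append_assoc]
    refine .of_sublistForall₂ hst.1 (fun _ => ?_) _
    exact .cons rfl hst.2 ih
  | cons_right _ ih =>
    rw [List.flatMap_cons, List.append_assoc]
    exact ih.append_left _

theorem MarkedEmb.exists_contraction {b : Bool} {l l' : List (Bool × A)} (h : MarkedEmb r b l l')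
    {x y : Bool × A} (hx : x.1 = b) (hy : y.1 = b) (hxy : r x.2 y.2) :
    ∃ π : ℕ → ℕ, π 0 = 0 ∧ (∀ j, π (j + 1) = π j ∨ π (j + 1) = π j + 1) ∧
      (∀ (k : ℕ) (u : Bool × A), (x :: l)[k]? = some u → ∃ (j : ℕ) (v : Bool × A),
        (y :: l')[j]? = some v ∧ π j = k ∧ u.1 = v.1 ∧ r u.2 v.2) ∧
      (∀ (j : ℕ) (v : Bool × A), (y :: l')[j]? = some v → ∃ u : Bool × A,
        (x :: l)[π j]? = some u ∧ (v.1 = true → u.1 = true)) := by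
  induction h generalizing x y with
  | nil =>
    refine ⟨fun _ => 0, rfl, by simp, fun k u hu => ⟨0, y, rfl, ?_⟩, fun j v hv => ⟨x, rfl, ?_⟩⟩
    · cases k <;> simp_all
    · cases j <;> simp_all
  | @skip b z l l' hz _ ih =>
    obtain ⟨π, h0, hstep, hmatch, hmark⟩ := ih hx hy hxy
    refine ⟨fun j => π (j - 1), h0, fun j => ?_, fun k u hu => ?_, fun j v hv => ?_⟩
    · cases j with
      | zero => exact Or.inl rfl
      | succ j => exact hstep j
    · obtain ⟨j, v, hv, hj, huv⟩ := hmatch k u hu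
      cases j with
      | zero => exact ⟨0, v, hv, hj, huv⟩
      | succ j => exact ⟨j + 2, v, hv, hj, huv⟩
    · match j, hv with
      | 0, hv => exact hmark 0 v hv
      | 1, hv =>
        refine ⟨x, by simp [h0], fun h => ?_⟩
        obtain rfl : z = v := by simpa using hv
        rw [hx, hz h]
      | j + 2, hv => exact hmark (j + 1) v hv
  | @cons b z t l l' hzt hr _ ih =>
    obtain ⟨π, h0, hstep, hmatch, hmark⟩ := ih rfl hzt.symm hr
    refine ⟨fun j => j.casesOn 0 (fun j => π j + 1), rfl, fun j => ?_, fun k u hu => ?_,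
      fun j v hv => ?_⟩
    · cases j with
      | zero => simp [h0]
      | succ j => have := hstep j; simp only; omega
    · cases k with
      | zero =>
        obtain rfl : x = u := by simpa using hu
        exact ⟨0, y, rfl, rfl, hx.trans hy.symm, hxy⟩
      | succ k =>
        obtain ⟨j, v, hv, hj, huv⟩ := hmatch k u hu
        exact ⟨j + 1, v, hv, by simp [hj], huv⟩
    · cases j with
      | zero =>
        obtain rfl : y = v := by simpa using hv
        exact ⟨x, rfl, fun h => by rw [hx, ← hy, h]⟩
      | succ j => exact hmark j v hv

end MarkedWords

section CycleModels

variable {S : Type*}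

/-- A presentation of a labeled graph having a cycle-multipartite decomposition: the cycle is
`0, …, n`, the vertices of the multipartite part form the type `R`, two of them being adjacent iff
they are in different classes, and `hub` singles out the vertices of the cycle which are complete
to `R`. -/
structure CycleModel (G : LabGraph S) where
  n : ℕ
  R : Type
  K : Type
  [fintypeR : Fintype R]
  [fintypeK : Fintype K]
  cls : R → K
  e : Fin G.n ≃ Fin (n + 1) ⊕ R
  hub : Fin (n + 1) → Prop
  adj_cycle : ∀ i j : Fin (n + 1), G.graph.Adj (e.symm (.inl i)) (e.symm (.inl j)) ↔
    i.val + 1 = j.val ∨ j.val + 1 = i.val ∨ (i.val = 0 ∧ j.val = n) ∨ (j.val = 0 ∧ i.val = n)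
  adj_spoke : ∀ i x, G.graph.Adj (e.symm (.inl i)) (e.symm (.inr x)) ↔ hub i
  adj_part : ∀ x y, G.graph.Adj (e.symm (.inr x)) (e.symm (.inr y)) ↔ cls x ≠ cls y
  hub_zero : ∀ i, hub i → hub 0

attribute [instance] CycleModel.fintypeR CycleModel.fintypeK

theorem cycleGraph_adj_iff_val {n : ℕ} (u v : Fin (n + 3)) : (cycleGraph (n + 3)).Adj u v ↔
    u.val + 1 = v.val ∨ v.val + 1 = u.val ∨ (u.val = 0 ∧ v.val = n + 2) ∨
      (v.val = 0 ∧ u.val = n + 2) := by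
  have key : ∀ a b : Fin (n + 3), a - b = 1 ↔ b.val + 1 = a.val ∨ (a.val = 0 ∧ b.val = n + 2) := by
    intro a b
    rw [sub_eq_iff_eq_add, add_comm 1 b, Fin.ext_iff, Fin.val_add_one]
    have ha := a.2
    have hb := b.2
    split_ifs with h
    · have : b.val = n + 2 := by rw [h]; rfl
      omega
    · have : b.val ≠ n + 2 := fun h' => h (Fin.ext h')
      omega
  rw [cycleGraph_adj, key, key]
  tauto

theorem cycleGraph_adj_add_right {n : ℕ} (u v d : Fin (n + 3)) :
    (cycleGraph (n + 3)).Adj (u + d) (v + d) ↔ (cycleGraph (n + 3)).Adj u v := by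
  simp [cycleGraph_adj]

open Classical in
theorem exists_cycleModel (G : LabGraph S) (hG : HasCycleMultipartiteDecomp G.graph) :
    Nonempty (CycleModel G) := by
  obtain ⟨C, R, hCR, hdisj, ⟨n, hn, ⟨ψ⟩⟩, ⟨s, hs⟩, hnb⟩ := hG
  obtain ⟨n, rfl⟩ : ∃ m, n = m + 3 := ⟨n - 3, by omega⟩
  obtain rfl : R = Cᶜ := (isCompl_iff.2 ⟨hdisj, codisjoint_iff.2 hCR⟩).compl_eq.symm
  let hub₀ : Fin (n + 3) → Prop := fun i => ∃ x : ↑Cᶜ, G.graph.Adj (ψ.symm i) x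
  obtain ⟨d, hd⟩ : ∃ d, ∀ i, hub₀ i → hub₀ d := by
    by_cases h : ∃ d, hub₀ d
    · exact ⟨h.choose, fun _ _ => h.choose_spec⟩
    · exact ⟨0, fun i hi => (h ⟨i, hi⟩).elim⟩
  let e : Fin G.n ≃ Fin (n + 3) ⊕ ↑Cᶜ := (Equiv.Set.sumCompl C).symm.trans
    (Equiv.sumCongr (ψ.toEquiv.trans (Equiv.addRight d).symm) (Equiv.refl _))
  have he₁ : ∀ i, e.symm (.inl i) = (ψ.symm (i + d) : Fin G.n) := fun i => rfl
  have he₂ : ∀ x, e.symm (.inr x) = (x : Fin G.n) := fun x => rfl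
  refine ⟨{
    n := n + 2
    R := ↑Cᶜ
    K := Quotient s
    cls := Quotient.mk s
    e := e
    hub := fun i => hub₀ (i + d)
    adj_cycle := fun i j => ?_
    adj_spoke := fun i x => ?_
    adj_part := fun x y => ?_
    hub_zero := fun i hi => ?_ }⟩
  · rw [he₁, he₁, ← cycleGraph_adj_iff_val, ← cycleGraph_adj_add_right i j d,
      ← ψ.symm.map_rel_iff]
    rfl
  · rw [he₁, he₂]
    refine ⟨fun h => ⟨x, h⟩, fun ⟨y, hy⟩ => ?_⟩
    exact ((hnb y y.2 x x.2 _ (ψ.symm (i + d)).2).1 hy.symm).symm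
  · rw [he₂, he₂, ne_eq, Quotient.eq]
    exact hs x y
  · rw [zero_add]
    exact hd _ hi

section Contraction

variable {π : ℕ → ℕ}

theorem monotone_of_step (hstep : ∀ j, π (j + 1) = π j ∨ π (j + 1) = π j + 1) : Monotone π :=
  monotone_nat_of_le_succ fun j => by have := hstep j; omega

theorem exists_jump (h0 : π 0 = 0) (hstep : ∀ j, π (j + 1) = π j ∨ π (j + 1) = π j + 1)
    {j k : ℕ} (hj : π j = k + 1) : ∃ i < j, π i = k ∧ π (i + 1) = k + 1 := by
  induction j with
  | zero => omega
  | succ j ih =>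
    rcases hstep j with h | h
    · obtain ⟨i, hi, hk⟩ := ih (by omega)
      exact ⟨i, by omega, hk⟩
    · exact ⟨j, by omega, by omega, hj⟩

variable {H G : LabGraph S}

/-- The vertex `x` of the second presentation belongs to the branch set of the vertex `a` of the
first one. -/
def InBranch {m n : ℕ} {R R' : Type} (π : ℕ → ℕ) (φ : R → R') :
    Fin (m + 1) ⊕ R → Fin (n + 1) ⊕ R' → Prop
  | .inl k, .inl j => π j = k
  | .inr x, .inr y => φ x = y
  | _, _ => False

theorem CycleModel.reachable_of_constant (M : CycleModel G) (T : Set (Fin G.n)) (d : ℕ)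
    (i j : Fin (M.n + 1)) (hij : i.val + d = j.val)
    (hT : ∀ t : Fin (M.n + 1), i ≤ t → t ≤ j → M.e.symm (.inl t) ∈ T)
    (hi : M.e.symm (.inl i) ∈ T) (hj : M.e.symm (.inl j) ∈ T) :
    (G.graph.induce T).Reachable ⟨_, hi⟩ ⟨_, hj⟩ := by
  induction d generalizing j with
  | zero =>
    obtain rfl : i = j := Fin.ext (by simpa using hij)
    exact .refl _
  | succ d ih =>
    have hlt := j.2
    let t : Fin (M.n + 1) := ⟨i.val + d, by omega⟩
    have htj : t ≤ j := Fin.le_def.2 (by simp only [t]; omega)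
    have ht : M.e.symm (.inl t) ∈ T := hT t (Fin.le_def.2 (by simp [t])) htj
    refine (ih t rfl (fun u hu hut => hT u hu (hut.trans htj)) ht).trans (Adj.reachable ?_)
    exact (M.adj_cycle t j).2 (Or.inl (by simp only [t]; omega))

open Classical in
theorem labIM_of_contraction {r : S → S → Prop} (M : CycleModel H) (M' : CycleModel G)
    (h0 : π 0 = 0) (hstep : ∀ j, π (j + 1) = π j ∨ π (j + 1) = π j + 1)
    (hmatch : ∀ k : Fin (M.n + 1), ∃ j : Fin (M'.n + 1), π j = k ∧ (M.hub k → M'.hub j) ∧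
      FinsetLE r (H.label (M.e.symm (.inl k))) (G.label (M'.e.symm (.inl j))))
    (hmark : ∀ j : Fin (M'.n + 1), ∃ k : Fin (M.n + 1), π j = k ∧ (M'.hub j → M.hub k))
    (φ : M.R → M'.R) (hφ : Function.Injective φ)
    (hcls : ∀ x y, M'.cls (φ x) = M'.cls (φ y) ↔ M.cls x = M.cls y)
    (hlab : ∀ x, FinsetLE r (H.label (M.e.symm (.inr x))) (G.label (M'.e.symm (.inr (φ x))))) :
    LabIM r H G := by
  have hmono := monotone_of_step hstep
  have hlast : π M'.n = M.n := by
    obtain ⟨j, hj, -⟩ := hmatch (Fin.last _)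
    obtain ⟨k, hk, -⟩ := hmark (Fin.last _)
    have h₁ := hmono (Nat.lt_succ_iff.1 j.2)
    have h₂ := k.2
    simp only [Fin.val_last] at hj hk
    omega
  have hrep : ∀ a, ∃ x, InBranch π φ a x ∧
      FinsetLE r (H.label (M.e.symm a)) (G.label (M'.e.symm x)) := by
    rintro (k | x)
    · obtain ⟨j, hj, -, hle⟩ := hmatch k
      exact ⟨.inl j, hj, hle⟩
    · exact ⟨.inr (φ x), rfl, hlab x⟩
  have hadj_cycle : ∀ k k' : Fin (M.n + 1), k ≠ k' →
      ((∃ j j' : Fin (M'.n + 1), π j = k ∧ π j' = k' ∧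
        G.graph.Adj (M'.e.symm (.inl j)) (M'.e.symm (.inl j'))) ↔
      H.graph.Adj (M.e.symm (.inl k)) (M.e.symm (.inl k'))) := by
    intro k k' hne
    have hne' : k.val ≠ k'.val := fun h => hne (Fin.ext h)
    have hjump : ∀ t t' : Fin (M.n + 1), t.val + 1 = t'.val → ∃ j j' : Fin (M'.n + 1),
        π j = t ∧ π j' = t' ∧ j.val + 1 = j'.val := by
      intro t t' ht
      obtain ⟨j, hj, -⟩ := hmatch t'
      obtain ⟨i, hi, h₁, h₂⟩ := exists_jump h0 hstep (hj.trans ht.symm)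
      have := j.2
      exact ⟨⟨i, by omega⟩, ⟨i + 1, by omega⟩, h₁, by rw [← ht, ← h₂], rfl⟩
    rw [M.adj_cycle]
    constructor
    · rintro ⟨j, j', hj, hj', h⟩
      rw [M'.adj_cycle] at h
      rcases h with h | h | ⟨h, h'⟩ | ⟨h, h'⟩
      · have := hstep j
        rw [h] at this
        omega
      · have := hstep j'
        rw [h] at this
        omega
      · rw [h] at hj
        rw [h'] at hj'
        omega
      · rw [h] at hj'
        rw [h'] at hj
        omega
    · rintro (h | h | ⟨h, h'⟩ | ⟨h, h'⟩)
      · obtain ⟨j, j', hj, hj', hjj'⟩ := hjump k k' h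
        exact ⟨j, j', hj, hj', (M'.adj_cycle j j').2 (Or.inl hjj')⟩
      · obtain ⟨j, j', hj, hj', hjj'⟩ := hjump k' k h
        exact ⟨j', j, hj', hj, (M'.adj_cycle j' j).2 (Or.inr (Or.inl hjj'))⟩
      · exact ⟨0, Fin.last _, by simp [h0, h], by simp [hlast, h'],
          (M'.adj_cycle _ _).2 (by simp)⟩
      · exact ⟨Fin.last _, 0, by simp [hlast, h'], by simp [h0, h],
          (M'.adj_cycle _ _).2 (by simp)⟩
  have hadj_spoke : ∀ (k : Fin (M.n + 1)) (x : M.R),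
      (∃ j : Fin (M'.n + 1), π j = k ∧
        G.graph.Adj (M'.e.symm (.inl j)) (M'.e.symm (.inr (φ x)))) ↔
      H.graph.Adj (M.e.symm (.inl k)) (M.e.symm (.inr x)) := by
    intro k x
    simp only [M.adj_spoke, M'.adj_spoke]
    constructor
    · rintro ⟨j, hj, h⟩
      obtain ⟨k', hk', hhub⟩ := hmark j
      obtain rfl : k = k' := Fin.ext (hj.symm.trans hk')
      exact hhub h
    · intro h
      obtain ⟨j, hj, hhub, -⟩ := hmatch k
      exact ⟨j, hj, hhub h⟩
  have hadj : ∀ a b, a ≠ b → ((∃ x y, InBranch π φ a x ∧ InBranch π φ b y ∧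
      G.graph.Adj (M'.e.symm x) (M'.e.symm y)) ↔ H.graph.Adj (M.e.symm a) (M.e.symm b)) := by
    rintro (k | x) (k' | x') hne
    · rw [← hadj_cycle k k' (fun h => hne (by rw [h]))]
      simp [InBranch]
    · rw [← hadj_spoke k x']
      simp [InBranch]
    · rw [H.graph.adj_comm, ← hadj_spoke k' x]
      simp [InBranch, G.graph.adj_comm]
    · rw [M.adj_part]
      simp [InBranch, M'.adj_part, hcls]
  refine ⟨fun a => Finset.univ.filter fun x => InBranch π φ (M.e a) (M'.e x), fun a => ?_,
    fun a b hab => ?_, fun a => ?_, fun a b hab => ?_, fun a => ?_⟩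
  · obtain ⟨x, hx, -⟩ := hrep (M.e a)
    exact ⟨M'.e.symm x, by simpa using hx⟩
  · rw [Finset.disjoint_left]
    intro x hx hx'
    simp only [Finset.mem_filter, Finset.mem_univ, true_and] at hx hx'
    refine hab (M.e.injective ?_)
    revert hx hx'
    rcases M.e a with k | y <;> rcases M.e b with k' | y' <;> rcases M'.e x with j | z <;>
      simp only [InBranch, false_implies, implies_true, Sum.inl.injEq, Sum.inr.injEq]
    · exact fun h h' => Fin.ext (h.symm.trans h')
    · exact fun h h' => hφ (h.trans h'.symm)
  · obtain ⟨x₀, hx₀, -⟩ := hrep (M.e a)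
    rw [connected_iff]
    refine ⟨?_, ⟨⟨M'.e.symm x₀, by simpa using hx₀⟩⟩⟩
    rintro ⟨x, hx⟩ ⟨y, hy⟩
    obtain ⟨x, rfl⟩ := M'.e.symm.surjective x
    obtain ⟨y, rfl⟩ := M'.e.symm.surjective y
    have hx' : InBranch π φ (M.e a) x := by simpa using hx
    have hy' : InBranch π φ (M.e a) y := by simpa using hy
    rcases hea : M.e a with k | z <;> rw [hea] at hx' hy' <;> rcases x with i | u <;>
      rcases y with j | v <;> simp only [InBranch] at hx' hy'
    · have hT : ∀ i j : Fin (M'.n + 1), π i = k → π j = k → ∀ t, i ≤ t → t ≤ j →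
          M'.e.symm (.inl t) ∈ (↑(Finset.univ.filter fun x => InBranch π φ (M.e a) (M'.e x)) :
            Set (Fin G.n)) := by
        intro i j hi hj t hit htj
        have h₁ := hmono (Fin.le_def.1 hit)
        have h₂ := hmono (Fin.le_def.1 htj)
        simp only [Finset.coe_filter, Finset.mem_univ, true_and, Set.mem_ofPred_eq,
          Equiv.apply_symm_apply, hea, InBranch]
        omega
      rcases le_total i j with h | h
      · exact M'.reachable_of_constant _ (j.val - i.val) i j
          (Nat.add_sub_cancel' (Fin.le_def.1 h)) (hT i j hx' hy') hx hy
      · exact (M'.reachable_of_constant _ (i.val - j.val) j i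
          (Nat.add_sub_cancel' (Fin.le_def.1 h)) (hT j i hy' hx') hy hx).symm
    · obtain rfl : u = v := hx'.symm.trans hy'
      exact .refl _
  · have := hadj (M.e a) (M.e b) (fun h => hab (M.e.injective h))
    rw [Equiv.symm_apply_apply, Equiv.symm_apply_apply] at this
    rw [← this]
    constructor
    · rintro ⟨x, hx, y, hy, h⟩
      exact ⟨M'.e x, M'.e y, by simpa using hx, by simpa using hy, by simpa using h⟩
    · rintro ⟨x, y, hx, hy, h⟩
      exact ⟨M'.e.symm x, by simpa using hx, M'.e.symm y, by simpa using hy, h⟩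
  · obtain ⟨x, hx, hle⟩ := hrep (M.e a)
    rw [Equiv.symm_apply_apply] at hle
    refine hle.mono_right ?_
    rw [labelUnion]
    exact Finset.subset_biUnion_of_mem G.label (by simpa using hx)

end Contraction

open Classical in
/-- The marked word read along the cycle, starting after its vertex `0`: the letter of a vertex is
its label, and the vertices complete to the multipartite part are marked. -/
noncomputable def CycleModel.word {G : LabGraph S} (M : CycleModel G) : List (Bool × Finset S) :=
  List.ofFn fun i : Fin M.n =>
    (decide (M.hub i.succ), G.label (M.e.symm (.inl i.succ)))

open Classical in
/-- The letter of the vertex `0` of the cycle. -/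
noncomputable def CycleModel.head {G : LabGraph S} (M : CycleModel G) : Bool × Finset S :=
  (decide (M.hub 0), G.label (M.e.symm (.inl 0)))

open Classical in
theorem CycleModel.getElem?_head_cons_word {G : LabGraph S} (M : CycleModel G) (k : ℕ)
    (u : Bool × Finset S) : (M.head :: M.word)[k]? = some u ↔ ∃ i : Fin (M.n + 1), i.val = k ∧
      u = (decide (M.hub i), G.label (M.e.symm (.inl i))) := by
  have : M.head :: M.word = List.ofFn fun i : Fin (M.n + 1) =>
      (decide (M.hub i), G.label (M.e.symm (.inl i))) := by
    rw [List.ofFn_succ]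
    rfl
  rw [this, List.getElem?_ofFn]
  constructor
  · intro h
    split_ifs at h with hk
    exact ⟨⟨k, hk⟩, rfl, (Option.some.inj h).symm⟩
  · rintro ⟨i, rfl, rfl⟩
    rw [dif_pos i.2]

open Classical in
/-- The labels of the multipartite part, grouped by class. -/
noncomputable def CycleModel.parts {G : LabGraph S} (M : CycleModel G) : List (List (Finset S)) :=
  valueList fun q : M.K => valueList fun x : {x // M.cls x = q} => G.label (M.e.symm (.inr x))

theorem CycleModel.exists_embedding_of_parts {r : S → S → Prop} {H G : LabGraph S}
    (M : CycleModel H) (M' : CycleModel G)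
    (h : List.SublistForall₂ (List.SublistForall₂ (FinsetLE r)) M.parts M'.parts) :
    ∃ φ : M.R → M'.R, Function.Injective φ ∧
      (∀ x y, M'.cls (φ x) = M'.cls (φ y) ↔ M.cls x = M.cls y) ∧
      ∀ x, FinsetLE r (H.label (M.e.symm (.inr x))) (G.label (M'.e.symm (.inr (φ x)))) := by
  classical
  obtain ⟨ψ, hψ⟩ := exists_embedding_of_valueList h
  choose χ hχ using fun q => exists_embedding_of_valueList (hψ q)
  have hval : ∀ q (x : {x // M.cls x = q}), M'.cls (χ q x) = ψ q := fun q x => (χ q x).2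
  have hcls : ∀ x y, M'.cls (χ (M.cls x) ⟨x, rfl⟩) = M'.cls (χ (M.cls y) ⟨y, rfl⟩) ↔
      M.cls x = M.cls y := by
    intro x y
    rw [hval, hval, ψ.injective.eq_iff]
  refine ⟨fun x => χ (M.cls x) ⟨x, rfl⟩, fun x y hxy => ?_, hcls, fun x => hχ (M.cls x) ⟨x, rfl⟩⟩
  have hc : M.cls x = M.cls y := (hcls x y).1 (congrArg M'.cls hxy)
  have key : ∀ p q (_ : p = q) (hx : M.cls x = p) (hy : M.cls y = q),
      (χ p ⟨x, hx⟩ : M'.R) = χ q ⟨y, hy⟩ → x = y := by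
    rintro p _ rfl hx hy h
    exact congrArg Subtype.val ((χ p).injective (Subtype.ext h))
  exact key _ _ hc rfl rfl hxy

theorem labIM_of_code {r : S → S → Prop} {H G : LabGraph S} (M : CycleModel H) (M' : CycleModel G)
    (hmark : M.head.1 = M'.head.1) (hhead : FinsetLE r M.head.2 M'.head.2)
    (hword : MarkedEmb (FinsetLE r) true M.word M'.word)
    (hparts : List.SublistForall₂ (List.SublistForall₂ (FinsetLE r)) M.parts M'.parts) :
    LabIM r H G := by
  classical
  obtain ⟨φ, hφ, hcls, hlab⟩ := M.exists_embedding_of_parts M' hparts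
  have hword' : MarkedEmb (FinsetLE r) M'.head.1 M.word M'.word := by
    by_cases h : M'.hub 0
    · simpa [CycleModel.head, h] using hword
    · refine hword.of_unmarked (fun y hy => ?_) _
      obtain ⟨i, rfl⟩ := List.mem_ofFn.1 hy
      simpa using fun hi => h (M'.hub_zero _ hi)
  obtain ⟨π, h0, hstep, hmatch, hcontr⟩ := hword'.exists_contraction hmark rfl hhead
  refine labIM_of_contraction M M' h0 hstep (fun k => ?_) (fun j => ?_) φ hφ hcls hlab
  · obtain ⟨j, v, hv, hj, hm, hle⟩ := hmatch k _ ((M.getElem?_head_cons_word _ _).2 ⟨k, rfl, rfl⟩)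
    obtain ⟨j, rfl, rfl⟩ := (M'.getElem?_head_cons_word _ _).1 hv
    exact ⟨j, hj, (decide_eq_decide.1 hm).1, hle⟩
  · obtain ⟨u, hu, hm⟩ := hcontr j _ ((M'.getElem?_head_cons_word _ _).2 ⟨j, rfl, rfl⟩)
    obtain ⟨k, hk, rfl⟩ := (M.getElem?_head_cons_word _ _).1 hu
    exact ⟨k, hk.symm, by simpa using hm⟩

end CycleModels

/-- For every wqo `(S, ≤)`, the `(S, ≤)`-labeled graphs admitting a cycle-multipartite
decomposition are well-quasi-ordered by the label-respecting induced minor relation. -/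
theorem labeled_cycleMultipartite_wqo_inducedMinor {S : Type*} [Preorder S]
    (hwqo : IsWqo ((· ≤ ·) : S → S → Prop))
    (f : ℕ → LabGraph S) (hf : ∀ i, HasCycleMultipartiteDecomp (f i).graph) :
    ∃ i j, i < j ∧ LabIM (· ≤ ·) (f i) (f j) := by
  have hlabel : WellQuasiOrdered (FinsetLE ((· ≤ ·) : S → S → Prop)) :=
    wellQuasiOrdered_finsetLE hwqo
  have M := fun i => (exists_cycleModel (f i) (hf i)).some
  choose w hw using fun i => markedWord_surjective (M i).word
  have hparts := wellQuasiOrdered_sublistForall₂ (wellQuasiOrdered_sublistForall₂ hlabel)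
  have hcode := (Finite.wellQuasiOrdered (α := Bool) Eq).prod
    (hlabel.prod (hparts.prod (wellQuasiOrdered_blockLE hlabel)))
  obtain ⟨i, j, hij, hmark, hhead, hp, hblock⟩ :=
    hcode fun i => ((M i).head.1, (M i).head.2, (M i).parts, w i)
  refine ⟨i, j, hij, labIM_of_code (M i) (M j) hmark hhead ?_ hp⟩
  rw [← hw, ← hw]
  exact hblock.markedEmb

end IMWQO
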